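/- arXiv:1808.06157 — 3 statements merged into one kernel-verified Lean document; each statement's English description precedes it below -/
import Mathlib

section
/- Let n ≥ 2 and q ≥ 2 be integers, and define F(x) = Σ_{a=1}^{⌊(n−1)/2⌋} Σ_{b=1}^{⌊(n−1)/2⌋} cos(2π⟨x, D_{a,b}⟩/q) for (n−1)×(n−1) matrices x over ℤ/qℤ. Then for every such x, every 1 ≤ i ≤ j ≤ n−1, 1 ≤ k ≤ l ≤ n−1 and σ ∈ {+1,−1}, |F(x + σ·Ã_{i,j,k,l}) − F(x)| ≤ 8. -/
/-- The matrix `Ã_{i,j,k,l}` (1-based indices): entry 1 at `(a,c)` iff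
`i ≤ a ≤ j` and `k ≤ c ≤ l`. -/
def Atil (n q : ℕ) (i j k l : ℕ) : Matrix (Fin (n - 1)) (Fin (n - 1)) (ZMod q) :=
  Matrix.of fun a c =>
    if (i ≤ (a : ℕ) + 1 ∧ (a : ℕ) + 1 ≤ j) ∧ (k ≤ (c : ℕ) + 1 ∧ (c : ℕ) + 1 ≤ l)
      then (1 : ZMod q) else 0

/-- Inner product `⟨y, z⟩ = Σ_{a,c} y(a,c)·z(a,c)` in `ℤ/qℤ`. -/
def inner2 {m q : ℕ} (y z : Matrix (Fin m) (Fin m) (ZMod q)) : ZMod q :=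
  ∑ a, ∑ c, y a c * z a c

/-- `cos(2πa/q)` for `a ∈ ℤ/qℤ`. -/
noncomputable def zcos (q : ℕ) (a : ZMod q) : ℝ :=
  Real.cos (2 * Real.pi * (a.val : ℝ) / q)


/-- The matrix `D_{a,b}` (1-based indices): entry 1 at `(2a-1,2b-1)` and `(2a,2b)`,
entry `-1` at `(2a,2b-1)` and `(2a-1,2b)`. -/
def Dmat (n q : ℕ) (a b : ℕ) : Matrix (Fin (n - 1)) (Fin (n - 1)) (ZMod q) :=
  Matrix.of fun s t =>
    (if (s : ℕ) + 1 = 2 * a - 1 ∧ (t : ℕ) + 1 = 2 * b - 1 then (1 : ZMod q) else 0)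
  + (if (s : ℕ) + 1 = 2 * a ∧ (t : ℕ) + 1 = 2 * b then 1 else 0)
  - (if (s : ℕ) + 1 = 2 * a ∧ (t : ℕ) + 1 = 2 * b - 1 then 1 else 0)
  - (if (s : ℕ) + 1 = 2 * a - 1 ∧ (t : ℕ) + 1 = 2 * b then 1 else 0)

/-- The difference of the indicators of the odd position `2a-1` and the even position `2a`. -/
def pairDiff (q a s : ℕ) : ZMod q :=
  (if s + 1 = 2 * a - 1 then 1 else 0) - (if s + 1 = 2 * a then 1 else 0)

/-- The indicator of the interval `[i, j]` at the 1-based position of `s`. -/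
def intervalInd (q i j s : ℕ) : ZMod q := if i ≤ s + 1 ∧ s + 1 ≤ j then 1 else 0

theorem inner2_add {m q : ℕ} (x y z : Matrix (Fin m) (Fin m) (ZMod q)) :
    inner2 (x + y) z = inner2 x z + inner2 y z := by
  simp [inner2, add_mul, Finset.sum_add_distrib]

theorem inner2_neg {m q : ℕ} (y z : Matrix (Fin m) (Fin m) (ZMod q)) :
    inner2 (-y) z = -inner2 y z := by
  simp [inner2]

theorem Dmat_apply (n q a b : ℕ) (s t : Fin (n - 1)) :
    Dmat n q a b s t = pairDiff q a s * pairDiff q b t := by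
  simp only [Dmat, pairDiff, Matrix.of_apply, ite_and]
  split_ifs <;> simp

theorem Atil_apply (n q i j k l : ℕ) (s t : Fin (n - 1)) :
    Atil n q i j k l s t = intervalInd q i j s * intervalInd q k l t := by
  simp only [Atil, intervalInd, Matrix.of_apply]
  split_ifs <;> simp_all

theorem inner2_Atil_Dmat (n q i j k l a b : ℕ) :
    inner2 (Atil n q i j k l) (Dmat n q a b) =
      (∑ s : Fin (n - 1), intervalInd q i j s * pairDiff q a s) *
        ∑ t : Fin (n - 1), intervalInd q k l t * pairDiff q b t := by
  simp only [inner2, Finset.sum_mul_sum, Dmat_apply, Atil_apply]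
  exact Finset.sum_congr rfl fun s _ => Finset.sum_congr rfl fun t _ => by ring

theorem sum_intervalInd_mul_pairDiff {m q i j a : ℕ} (ha : 1 ≤ a) (ham : a ≤ m / 2)
    (h : a ∉ ({i / 2, (j + 1) / 2} : Finset ℕ)) :
    ∑ s : Fin m, intervalInd q i j s * pairDiff q a s = 0 := by
  simp only [Finset.mem_insert, Finset.mem_singleton, not_or] at h
  have h1 : ∀ s : Fin m, (s : ℕ) + 1 = 2 * a - 1 ↔ s = ⟨2 * a - 2, by omega⟩ := fun s => by
    rw [Fin.ext_iff]; dsimp only; omega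
  have h2 : ∀ s : Fin m, (s : ℕ) + 1 = 2 * a ↔ s = ⟨2 * a - 1, by omega⟩ := fun s => by
    rw [Fin.ext_iff]; dsimp only; omega
  simp only [pairDiff, h1, h2, mul_sub, Finset.sum_sub_distrib, mul_ite, mul_one, mul_zero,
    Finset.sum_ite_eq', Finset.mem_univ, if_true, intervalInd]
  rw [sub_eq_zero]
  exact if_congr (by omega) rfl rfl

theorem abs_zcos_sub_zcos_le (q : ℕ) (u v : ZMod q) : |zcos q u - zcos q v| ≤ 2 := by
  unfold zcos
  rw [abs_le]
  constructor <;>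
    linarith [Real.cos_le_one (2 * Real.pi * (u.val : ℝ) / q),
      Real.neg_one_le_cos (2 * Real.pi * (u.val : ℝ) / q),
      Real.cos_le_one (2 * Real.pi * (v.val : ℝ) / q),
      Real.neg_one_le_cos (2 * Real.pi * (v.val : ℝ) / q)]

theorem sum_indicator_pair_le (S : Finset ℕ) (c d : ℕ) :
    ∑ a ∈ S, (if a ∈ ({c, d} : Finset ℕ) then (1 : ℝ) else 0) ≤ 2 := by
  rw [Finset.sum_boole]
  have h : (S.filter (· ∈ ({c, d} : Finset ℕ))).card ≤ 2 :=
    (Finset.card_le_card fun a ha => (Finset.mem_filter.mp ha).2).trans Finset.card_le_two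
  exact_mod_cast h

theorem stmt10 (n q : ℕ) (hn : 2 ≤ n) (hq : 2 ≤ q)
    (F : Matrix (Fin (n - 1)) (Fin (n - 1)) (ZMod q) → ℝ)
    (hF : ∀ x, F x = ∑ a ∈ Finset.Icc 1 ((n - 1) / 2), ∑ b ∈ Finset.Icc 1 ((n - 1) / 2),
        zcos q (inner2 x (Dmat n q a b)))
    (x : Matrix (Fin (n - 1)) (Fin (n - 1)) (ZMod q))
    (i j k l : ℕ) (hi : 1 ≤ i) (hij : i ≤ j) (hj : j ≤ n - 1)
    (hk : 1 ≤ k) (hkl : k ≤ l) (hl : l ≤ n - 1) (σ : Bool) :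
    |F (x + (if σ then Atil n q i j k l else - Atil n q i j k l)) - F x| ≤ 8 := by
  have key : ∀ a ∈ Finset.Icc 1 ((n - 1) / 2), ∀ b ∈ Finset.Icc 1 ((n - 1) / 2),
      |zcos q (inner2 (x + (if σ then Atil n q i j k l else - Atil n q i j k l))
          (Dmat n q a b)) - zcos q (inner2 x (Dmat n q a b))| ≤
        2 * ((if a ∈ ({i / 2, (j + 1) / 2} : Finset ℕ) then (1 : ℝ) else 0) *
          (if b ∈ ({k / 2, (l + 1) / 2} : Finset ℕ) then (1 : ℝ) else 0)) := by
    intro a ha b hb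
    rw [Finset.mem_Icc] at ha hb
    by_cases h : a ∈ ({i / 2, (j + 1) / 2} : Finset ℕ) ∧ b ∈ ({k / 2, (l + 1) / 2} : Finset ℕ)
    · rw [if_pos h.1, if_pos h.2, mul_one, mul_one]
      exact abs_zcos_sub_zcos_le _ _ _
    · have h0 : inner2 (Atil n q i j k l) (Dmat n q a b) = 0 := by
        rw [inner2_Atil_Dmat]
        rcases not_and_or.mp h with h | h
        · rw [sum_intervalInd_mul_pairDiff ha.1 ha.2 h, zero_mul]
        · rw [sum_intervalInd_mul_pairDiff hb.1 hb.2 h, mul_zero]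
      have h1 : inner2 (if σ then Atil n q i j k l else - Atil n q i j k l)
          (Dmat n q a b) = 0 := by
        cases σ <;> simp [inner2_neg, h0]
      rw [inner2_add, h1, add_zero, sub_self, abs_zero]
      positivity
  rw [hF, hF, ← Finset.sum_sub_distrib]
  simp_rw [← Finset.sum_sub_distrib]
  refine (Finset.abs_sum_le_sum_abs _ _).trans ((Finset.sum_le_sum fun a ha =>
    (Finset.abs_sum_le_sum_abs _ _).trans (Finset.sum_le_sum (key a ha))).trans ?_)
  simp_rw [← Finset.mul_sum]
  rw [← Finset.sum_mul]
  have hB := sum_indicator_pair_le (Finset.Icc 1 ((n - 1) / 2)) (k / 2) ((l + 1) / 2)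
  have hA := sum_indicator_pair_le (Finset.Icc 1 ((n - 1) / 2)) (i / 2) ((j + 1) / 2)
  have hAB := mul_le_mul hA hB (Finset.sum_nonneg fun _ _ => by positivity) zero_le_two
  linarith
end

section
/- Let n ≥ 3 and q ≥ 2 be integers, and let y be an (n−1)×(n−1) matrix over ℤ/qℤ. For each row i ∈ {1,…,n−1}, let Ψ_i be a set of pairs (k,l) with 1 ≤ k ≤ l ≤ n−1 such that each [k,l] ∈ Ψ_i is a nonzero interval of the i-th row of y, and suppose Ψ_i ∩ Ψ_{i+1} = ∅ for every 1 ≤ i ≤ n−2. Then 2·N(y) ≥ (|Ψ_1| + |Ψ_2| + ⋯ + |Ψ_{n−1}|)·n. -/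
/-- `Σ_{h=i}^{j} u_h` (1-based indices) for a vector `u`. -/
def isum {m q : ℕ} (u : Fin m → ZMod q) (i j : ℕ) : ZMod q :=
  ∑ a ∈ Finset.univ.filter (fun a : Fin m => i ≤ (a : ℕ) + 1 ∧ (a : ℕ) + 1 ≤ j), u a

/-- `S(u)`: the number of nonzero intervals of `u` (1-based intervals `[i,j] ⊆ [1,m]`). -/
def nzIntervals {m q : ℕ} (u : Fin m → ZMod q) : ℕ :=
  ((Finset.Icc 1 m ×ˢ Finset.Icc 1 m).filter
    (fun p => p.1 ≤ p.2 ∧ isum u p.1 p.2 ≠ 0)).card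

/-- The sum of the entries of `y` over the box `[i,j] × [k,l]` (1-based indices). -/
def bsum {m q : ℕ} (y : Matrix (Fin m) (Fin m) (ZMod q)) (i j k l : ℕ) : ZMod q :=
  ∑ a ∈ Finset.univ.filter (fun a : Fin m => i ≤ (a : ℕ) + 1 ∧ (a : ℕ) + 1 ≤ j),
    ∑ c ∈ Finset.univ.filter (fun c : Fin m => k ≤ (c : ℕ) + 1 ∧ (c : ℕ) + 1 ≤ l), y a c

/-- `N(y)`: the number of nonzero boxes of `y`. -/
def Nboxes {m q : ℕ} (y : Matrix (Fin m) (Fin m) (ZMod q)) : ℕ :=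
  (((Finset.Icc 1 m ×ˢ Finset.Icc 1 m) ×ˢ (Finset.Icc 1 m ×ˢ Finset.Icc 1 m)).filter
    (fun p => p.1.1 ≤ p.1.2 ∧ p.2.1 ≤ p.2.2 ∧ bsum y p.1.1 p.1.2 p.2.1 p.2.2 ≠ 0)).card

lemma isum_add_isum {m q : ℕ} (u : Fin m → ZMod q) {i j : ℕ} (hij : i ≤ j) :
    isum u 1 i + isum u (i + 1) j = isum u 1 j := by
  unfold isum
  rw [← Finset.sum_union]
  · congr 1
    ext a
    simp only [Finset.mem_union, Finset.mem_filter, Finset.mem_univ, true_and]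
    omega
  · rw [Finset.disjoint_left]
    intro a
    simp only [Finset.mem_filter, Finset.mem_univ, true_and]
    omega

lemma isum_self {m q : ℕ} (u : Fin m → ZMod q) (i : Fin m) :
    isum u (i + 1) (i + 1) = u i := by
  have h : Finset.univ.filter
      (fun a : Fin m => (i : ℕ) + 1 ≤ (a : ℕ) + 1 ∧ (a : ℕ) + 1 ≤ (i : ℕ) + 1) = {i} := by
    ext a
    simp only [Finset.mem_filter, Finset.mem_univ, true_and, Finset.mem_singleton, Fin.ext_iff]
    omega
  rw [isum, h, Finset.sum_singleton]

/-- The ordered pairs of distinct prefix sums number at most twice the nonzero intervals. -/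
lemma card_prefix_ne_le {m q : ℕ} (u : Fin m → ZMod q) :
    ∑ a ∈ Finset.range (m + 1),
      ((Finset.range (m + 1)).filter (fun c => isum u 1 a ≠ isum u 1 c)).card
      ≤ 2 * nzIntervals u := by
  classical
  rw [← Finset.card_sigma, two_mul, nzIntervals]
  set U := (Finset.Icc 1 m ×ˢ Finset.Icc 1 m).filter
    (fun p => p.1 ≤ p.2 ∧ isum u p.1 p.2 ≠ 0) with hU
  have key : ∀ a b, a ≤ b → b ≤ m → isum u 1 a ≠ isum u 1 b → (a + 1, b) ∈ U := by
    intro a b hab hb hne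
    have h := isum_add_isum u hab
    have hlt : a ≠ b := fun h' => hne (by rw [h'])
    simp only [hU, Finset.mem_filter, Finset.mem_product, Finset.mem_Icc]
    refine ⟨by omega, by omega, fun h0 => hne ?_⟩
    rw [h0, add_zero] at h
    exact h
  refine (Finset.card_le_card (t := U.image (fun p => (⟨p.1 - 1, p.2⟩ : Σ _ : ℕ, ℕ)) ∪
    U.image (fun p => (⟨p.2, p.1 - 1⟩ : Σ _ : ℕ, ℕ))) ?_).trans
    ((Finset.card_union_le _ _).trans (add_le_add Finset.card_image_le Finset.card_image_le))
  rintro ⟨a, b⟩ h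
  simp only [Finset.mem_sigma, Finset.mem_filter, Finset.mem_range] at h
  obtain ⟨ha, hb, hne⟩ := h
  rw [Finset.mem_union, Finset.mem_image, Finset.mem_image]
  rcases le_total a b with hab | hab
  · exact Or.inl ⟨_, key a b hab (by omega) hne, rfl⟩
  · exact Or.inr ⟨_, key b a hab (by omega) hne.symm, rfl⟩

lemma card_mul_le_two_mul_nzIntervals {m q : ℕ} (u : Fin m → ZMod q) (R : Finset (Fin m))
    (hR : ∀ i ∈ R, u i ≠ 0) (hsucc : ∀ i ∈ R, ∀ j ∈ R, (j : ℕ) ≠ i + 1) :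
    R.card * (m + 1) ≤ 2 * nzIntervals u := by
  classical
  refine le_trans ?_ (card_prefix_ne_le u)
  set d : ℕ → ℕ := fun a =>
    ((Finset.range (m + 1)).filter (fun c => isum u 1 a ≠ isum u 1 c)).card with hd
  have hdeg : ∀ i ∈ R, m + 1 ≤ d i + d (i + 1) := by
    intro i hi
    have hne : isum u 1 i ≠ isum u 1 (i + 1) := by
      intro h
      have h' := isum_add_isum u (Nat.le_succ (i : ℕ))
      rw [Nat.succ_eq_add_one, isum_self, ← h, add_eq_left] at h'
      exact hR i hi h'
    calc m + 1 = (Finset.range (m + 1)).card := (Finset.card_range _).symm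
      _ ≤ _ := Finset.card_le_card ?_
      _ ≤ d i + d (i + 1) := Finset.card_union_le _ _
    intro c hc
    rw [Finset.mem_union, Finset.mem_filter, Finset.mem_filter]
    by_cases h : isum u 1 i = isum u 1 c
    · exact Or.inr ⟨hc, fun h' => hne (h.trans h'.symm)⟩
    · exact Or.inl ⟨hc, h⟩
  have hdisj : Disjoint (R.image fun i : Fin m => (i : ℕ)) (R.image fun i : Fin m => (i : ℕ) + 1) := by
    rw [Finset.disjoint_left]
    intro x hx hx'
    obtain ⟨j, hj, rfl⟩ := Finset.mem_image.1 hx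
    obtain ⟨i, hi, h⟩ := Finset.mem_image.1 hx'
    exact hsucc i hi j hj h.symm
  calc R.card * (m + 1) ≤ ∑ i ∈ R, (d i + d (i + 1)) := by
        rw [← smul_eq_mul]
        exact Finset.card_nsmul_le_sum _ _ _ hdeg
    _ = ∑ a ∈ (R.image fun i : Fin m => (i : ℕ)) ∪ (R.image fun i : Fin m => (i : ℕ) + 1), d a := by
        rw [Finset.sum_union hdisj, Finset.sum_image, Finset.sum_image, Finset.sum_add_distrib]
        · intro a _ b _ h
          exact Fin.ext (Nat.succ_injective h)
        · intro a _ b _ h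
          exact Fin.ext h
    _ ≤ ∑ a ∈ Finset.range (m + 1), d a := by
        refine Finset.sum_le_sum_of_subset ?_
        intro x hx
        rw [Finset.mem_union, Finset.mem_image, Finset.mem_image] at hx
        rw [Finset.mem_range]
        rcases hx with ⟨i, _, rfl⟩ | ⟨i, _, rfl⟩ <;> omega

lemma Nboxes_eq_sum_nzIntervals {m q : ℕ} (y : Matrix (Fin m) (Fin m) (ZMod q)) :
    Nboxes y = ∑ p ∈ (Finset.Icc 1 m ×ˢ Finset.Icc 1 m).filter (fun p => p.1 ≤ p.2),
      nzIntervals (fun a => isum (y a) p.1 p.2) := by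
  unfold Nboxes nzIntervals
  rw [← Finset.card_sigma]
  refine Finset.card_bij' (fun p _ => ⟨p.2, p.1⟩) (fun s _ => (s.2, s.1)) ?_ ?_ ?_ ?_
  · intro p hp
    simp only [Finset.mem_sigma, Finset.mem_filter, Finset.mem_product] at hp ⊢
    exact ⟨⟨hp.1.2, hp.2.2.1⟩, hp.1.1, hp.2.1, hp.2.2.2⟩
  · intro s hs
    simp only [Finset.mem_sigma, Finset.mem_filter, Finset.mem_product] at hs ⊢
    exact ⟨⟨hs.2.1, hs.1.1⟩, hs.2.2.1, hs.1.2, hs.2.2.2⟩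
  · intro _ _
    rfl
  · intro _ _
    rfl

theorem stmt13 (n q : ℕ) (hn : 3 ≤ n) (hq : 2 ≤ q)
    (y : Matrix (Fin (n - 1)) (Fin (n - 1)) (ZMod q))
    (Ψ : Fin (n - 1) → Finset (ℕ × ℕ))
    (hΨ : ∀ i, ∀ p ∈ Ψ i, 1 ≤ p.1 ∧ p.1 ≤ p.2 ∧ p.2 ≤ n - 1 ∧ isum (y i) p.1 p.2 ≠ 0)
    (hdisj : ∀ i : Fin (n - 1), ∀ hi : (i : ℕ) + 1 < n - 1, Ψ i ∩ Ψ ⟨(i : ℕ) + 1, hi⟩ = ∅) :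
    (∑ i, (Ψ i).card) * n ≤ 2 * Nboxes y := by
  have hcount : ∑ i, (Ψ i).card =
      ∑ p ∈ (Finset.Icc 1 (n - 1) ×ˢ Finset.Icc 1 (n - 1)).filter (fun p => p.1 ≤ p.2),
        (Finset.univ.filter (fun i => p ∈ Ψ i)).card := by
    simp only [Finset.card_eq_sum_ones]
    refine Finset.sum_comm' ?_
    intro i p
    simp only [Finset.mem_filter, Finset.mem_univ, true_and, Finset.mem_product, Finset.mem_Icc]
    refine ⟨fun h => ⟨h, ?_⟩, fun h => h.1⟩
    have := hΨ i p h
    omega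
  rw [hcount, Nboxes_eq_sum_nzIntervals, Finset.sum_mul, Finset.mul_sum]
  refine Finset.sum_le_sum fun p _ => ?_
  have h := card_mul_le_two_mul_nzIntervals (fun a => isum (y a) p.1 p.2)
    (Finset.univ.filter (fun i => p ∈ Ψ i))
    (fun i hi => (hΨ i p (Finset.mem_filter.1 hi).2).2.2.2) ?_
  · rwa [Nat.sub_add_cancel (by omega)] at h
  · intro i hi j hj hji
    have hlt : (i : ℕ) + 1 < n - 1 := hji ▸ j.isLt
    obtain rfl : j = ⟨(i : ℕ) + 1, hlt⟩ := Fin.ext hji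
    have hmem := Finset.mem_inter.2 ⟨(Finset.mem_filter.1 hi).2, (Finset.mem_filter.1 hj).2⟩
    rw [hdisj i hlt] at hmem
    exact Finset.notMem_empty _ hmem
end

section
/- Let n ≥ 3 and q ≥ 2 be integers, let ε be a real number with 0 < ε ≤ 1/80, and let w be an integer with 1 ≤ w ≤ min{1/(100ε), ε·n}. Then the number of (n−1)×(n−1) matrices y over ℤ/qℤ with N(y) ≤ (w + 1/2)·n² is at most q^{32w}·n^{2w}. -/
/-- The sum of a function over the (1-based) interval `[i + 1, j]` is a difference of prefix sums. -/
theorem sum_interval_eq_sub {m : ℕ} {M : Type*} [AddCommGroup M] (f : Fin m → M) {i j : ℕ}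
    (hij : i ≤ j) :
    ∑ a ∈ Finset.univ.filter (fun a : Fin m => i + 1 ≤ (a : ℕ) + 1 ∧ (a : ℕ) + 1 ≤ j), f a =
      ∑ a ∈ Finset.univ.filter (fun a : Fin m => 1 ≤ (a : ℕ) + 1 ∧ (a : ℕ) + 1 ≤ j), f a -
      ∑ a ∈ Finset.univ.filter (fun a : Fin m => 1 ≤ (a : ℕ) + 1 ∧ (a : ℕ) + 1 ≤ i), f a := by
  rw [eq_sub_iff_add_eq, ← Finset.sum_union]
  · congr 1
    ext a
    simp only [Finset.mem_union, Finset.mem_filter, Finset.mem_univ, true_and]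
    omega
  · rw [Finset.disjoint_left]
    intro a
    simp only [Finset.mem_filter, Finset.mem_univ, true_and]
    omega

/-- The alternating sum of `z` over the corners `(s.1, s.2), (t.1, s.2), (s.1, t.2), (t.1, t.2)`. -/
def cornerSum {α β G : Type*} [AddCommGroup G] (z : α × β → G) (s t : α × β) : G :=
  z s - z (t.1, s.2) - z (s.1, t.2) + z t

/-- The matrix of mixed differences of a potential on the grid points. -/
def mixedDiff {m q : ℕ} (z : Fin (m + 1) × Fin (m + 1) → ZMod q) :
    Matrix (Fin m) (Fin m) (ZMod q) :=
  Matrix.of fun a c => cornerSum z (a.succ, c.succ) (a.castSucc, c.castSucc)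

/-- The two-dimensional prefix sums of `y`. -/
def prefixSum {m q : ℕ} (y : Matrix (Fin m) (Fin m) (ZMod q)) (s : Fin (m + 1) × Fin (m + 1)) :
    ZMod q :=
  bsum y 1 s.1 1 s.2

theorem bsum_eq_cornerSum {m q : ℕ} (y : Matrix (Fin m) (Fin m) (ZMod q))
    {i j k l : Fin (m + 1)} (hij : i ≤ j) (hkl : k ≤ l) :
    bsum y (i + 1) j (k + 1) l = cornerSum (prefixSum y) (j, l) (i, k) := by
  simp only [bsum, cornerSum, prefixSum]
  rw [sum_interval_eq_sub _ (show (i : ℕ) ≤ j from hij)]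
  simp only [sum_interval_eq_sub _ (show (k : ℕ) ≤ l from hkl), Finset.sum_sub_distrib]
  abel

theorem mixedDiff_prefixSum {m q : ℕ} (y : Matrix (Fin m) (Fin m) (ZMod q)) :
    mixedDiff (prefixSum y) = y := by
  ext a c
  have h (b : Fin m) : Finset.univ.filter
      (fun x : Fin m => (b : ℕ) + 1 ≤ (x : ℕ) + 1 ∧ (x : ℕ) + 1 ≤ (b : ℕ) + 1) = {b} := by
    ext x
    simp only [Finset.mem_filter, Finset.mem_univ, true_and, Finset.mem_singleton, Fin.ext_iff]
    omega
  rw [mixedDiff, Matrix.of_apply,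
    ← bsum_eq_cornerSum y (Fin.castSucc_lt_succ).le (Fin.castSucc_lt_succ).le]
  simp only [bsum, Fin.val_succ, Fin.val_castSucc, h, Finset.sum_singleton]

/-- Normalising a potential to vanish on the row and the column through `t` does not change its
corner sums. -/
theorem cornerSum_cornerSum {α β G : Type*} [AddCommGroup G] (z : α × β → G) (t s s' : α × β) :
    cornerSum (fun c => cornerSum z c t) s s' = cornerSum z s s' := by
  simp only [cornerSum]
  abel

/-- The (1-based) box spanned by two grid points. -/
def spannedBox {m : ℕ} (p : (Fin (m + 1) × Fin (m + 1)) × (Fin (m + 1) × Fin (m + 1))) :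
    (ℕ × ℕ) × (ℕ × ℕ) :=
  (((min p.1.1 p.2.1 : Fin (m + 1)) + 1, (max p.1.1 p.2.1 : Fin (m + 1))),
    ((min p.1.2 p.2.2 : Fin (m + 1)) + 1, (max p.1.2 p.2.2 : Fin (m + 1))))

/-- The set of boxes counted by `Nboxes`. -/
def nzBoxes {m q : ℕ} (y : Matrix (Fin m) (Fin m) (ZMod q)) : Finset ((ℕ × ℕ) × (ℕ × ℕ)) :=
  ((Finset.Icc 1 m ×ˢ Finset.Icc 1 m) ×ˢ (Finset.Icc 1 m ×ˢ Finset.Icc 1 m)).filter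
    (fun p => p.1.1 ≤ p.1.2 ∧ p.2.1 ≤ p.2.2 ∧ bsum y p.1.1 p.1.2 p.2.1 p.2.2 ≠ 0)

theorem spannedBox_mem_nzBoxes {m q : ℕ} (y : Matrix (Fin m) (Fin m) (ZMod q))
    (s t : Fin (m + 1) × Fin (m + 1)) (h : cornerSum (prefixSum y) s t ≠ 0) :
    spannedBox (s, t) ∈ nzBoxes y := by
  obtain ⟨a, b⟩ := s
  obtain ⟨a', b'⟩ := t
  have ha : a ≠ a' := by
    rintro rfl
    exact h (by simp [cornerSum])
  have hb : b ≠ b' := by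
    rintro rfl
    exact h (by simp [cornerSum])
  simp only [nzBoxes, spannedBox, Finset.mem_filter, Finset.mem_product, Finset.mem_Icc]
  rw [bsum_eq_cornerSum y min_le_max min_le_max]
  have hR : cornerSum (prefixSum y) (max a a', max b b') (min a a', min b b') ≠ 0 := by
    intro h0
    apply h
    simp only [cornerSum] at h0 ⊢
    rcases le_total a a' with h1 | h1 <;> rcases le_total b b' with h2 | h2 <;>
      simp only [h1, h2, max_eq_left, max_eq_right, min_eq_left, min_eq_right] at h0 <;>
      first
        | linear_combination h0
        | linear_combination -h0
  refine ⟨?_, ?_, ?_, hR⟩ <;> grind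

/-- Each box is spanned by at most four ordered pairs of opposite corners. -/
theorem card_cornerSum_ne_zero_le {m q : ℕ} (y : Matrix (Fin m) (Fin m) (ZMod q)) :
    (Finset.univ.filter (fun p : (Fin (m + 1) × Fin (m + 1)) × (Fin (m + 1) × Fin (m + 1)) =>
      cornerSum (prefixSum y) p.1 p.2 ≠ 0)).card ≤ 4 * Nboxes y := by
  classical
  refine Finset.card_le_mul_card_image_of_maps_to (t := nzBoxes y) (f := spannedBox)
    (fun p hp => spannedBox_mem_nzBoxes y p.1 p.2 (Finset.mem_filter.1 hp).2) 4 ?_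
  rintro ⟨⟨i, j⟩, ⟨k, l⟩⟩ -
  have hinj : Function.Injective
      (fun p : (Fin (m + 1) × Fin (m + 1)) × (Fin (m + 1) × Fin (m + 1)) =>
        (((p.1.1 : ℕ), (p.2.1 : ℕ)), ((p.1.2 : ℕ), (p.2.2 : ℕ)))) := by
    rintro ⟨⟨a, b⟩, ⟨a', b'⟩⟩ ⟨⟨c, d⟩, ⟨c', d'⟩⟩ h
    simp only [Prod.mk.injEq, Fin.ext_iff] at h ⊢
    tauto
  rw [← Finset.card_image_of_injective _ hinj]
  refine (Finset.card_le_card (t := ({(i - 1, j), (j, i - 1)} : Finset (ℕ × ℕ)) ×ˢ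
    ({(k - 1, l), (l, k - 1)} : Finset (ℕ × ℕ))) ?_).trans ?_
  · intro x hx
    simp only [Finset.mem_image, Finset.mem_filter, Finset.mem_univ, true_and] at hx
    obtain ⟨⟨⟨a, b⟩, ⟨a', b'⟩⟩, ⟨-, hp⟩, rfl⟩ := hx
    simp only [spannedBox, Prod.mk.injEq] at hp
    obtain ⟨⟨rfl, rfl⟩, ⟨rfl, rfl⟩⟩ := hp
    simp only [Finset.mem_product, Finset.mem_insert, Finset.mem_singleton, Prod.mk.injEq]
    rcases le_total a a' with h1 | h1 <;> rcases le_total b b' with h2 | h2 <;>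
      simp [h1, h2]
  · rw [Finset.card_product]
    exact Nat.mul_le_mul Finset.card_le_two Finset.card_le_two

/-- Some normalisation of the prefix sums has at most `4 N(y) / (m + 1) ^ 2` nonzero values. -/
theorem exists_base_card_le {m q : ℕ} (y : Matrix (Fin m) (Fin m) (ZMod q)) :
    ∃ t : Fin (m + 1) × Fin (m + 1),
      (m + 1) * (m + 1) *
        (Finset.univ.filter (fun s => cornerSum (prefixSum y) s t ≠ 0)).card ≤ 4 * Nboxes y := by
  classical
  by_contra! h
  have h1 := Finset.sum_lt_sum_of_nonempty (s := Finset.univ) Finset.univ_nonempty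
    (fun t _ => h t)
  rw [Finset.sum_const, ← Finset.mul_sum, Finset.card_univ, Fintype.card_prod, Fintype.card_fin,
    smul_eq_mul] at h1
  have h2 : ∑ t, (Finset.univ.filter (fun s => cornerSum (prefixSum y) s t ≠ 0)).card ≤
      4 * Nboxes y := by
    refine le_trans (le_of_eq ?_) (card_cornerSum_ne_zero_le y)
    simp only [Finset.card_filter]
    exact (Fintype.sum_prod_type_right
      (fun p : (Fin (m + 1) × Fin (m + 1)) × (Fin (m + 1) × Fin (m + 1)) =>
        if cornerSum (prefixSum y) p.1 p.2 ≠ 0 then 1 else 0)).symm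
  exact absurd (Nat.mul_le_mul_left _ h2) (not_le.2 h1)

/-- Ordered pairs of grid points not on a common line for which the first, but none of the other
three corners of the spanned rectangle, lies in `S`. -/
def isolatedCorners {α : Type*} [Fintype α] [DecidableEq α] (S : Finset (α × α)) :
    Finset ((α × α) × (α × α)) :=
  S.sigma (fun s => ((Finset.univ.erase s.1) ×ˢ (Finset.univ.erase s.2)).filter
    (fun t => (t.1, s.2) ∉ S ∧ (s.1, t.2) ∉ S ∧ t ∉ S)) |>.map
    (Equiv.sigmaEquivProd _ _).toEmbedding

theorem mem_isolatedCorners {α : Type*} [Fintype α] [DecidableEq α] {S : Finset (α × α)}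
    {p : (α × α) × (α × α)} :
    p ∈ isolatedCorners S ↔ p.1 ∈ S ∧ p.2.1 ≠ p.1.1 ∧ p.2.2 ≠ p.1.2 ∧
      (p.2.1, p.1.2) ∉ S ∧ (p.1.1, p.2.2) ∉ S ∧ p.2 ∉ S := by
  obtain ⟨s, t⟩ := p
  simp [isolatedCorners, Finset.mem_map_equiv, and_assoc]

theorem le_card_isolatedCorners {α : Type*} [Fintype α] [DecidableEq α] (S : Finset (α × α)) :
    S.card * ((Fintype.card α - 1) * (Fintype.card α - 1)) ≤
      (isolatedCorners S).card + S.card * (S.card * Fintype.card α) := by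
  rw [isolatedCorners, Finset.card_map, Finset.card_sigma, ← smul_eq_mul S.card, ← smul_eq_mul
    S.card (_ * _), ← Finset.sum_const, ← Finset.sum_const, ← Finset.sum_add_distrib]
  refine Finset.sum_le_sum fun s _ => ?_
  set B : α × α → Finset (α × α) := fun t =>
    if t.1 = s.1 then Finset.univ ×ˢ {t.2} else {t.1} ×ˢ Finset.univ with hB
  have hBcard : (S.biUnion B).card ≤ S.card * Fintype.card α := by
    refine Finset.card_biUnion_le_card_mul _ _ _ fun t _ => ?_
    simp only [hB]
    split_ifs <;> simp
  have hsub : (Finset.univ.erase s.1) ×ˢ (Finset.univ.erase s.2) ⊆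
      ((Finset.univ.erase s.1) ×ˢ (Finset.univ.erase s.2)).filter
        (fun t => (t.1, s.2) ∉ S ∧ (s.1, t.2) ∉ S ∧ t ∉ S) ∪ S.biUnion B := by
    intro t ht
    rw [Finset.mem_union, or_iff_not_imp_left]
    intro hn
    rw [Finset.mem_biUnion]
    simp only [Finset.mem_product, Finset.mem_erase, Finset.mem_univ, and_true] at ht
    have : (t.1, s.2) ∈ S ∨ (s.1, t.2) ∈ S ∨ t ∈ S := by
      by_contra! h
      exact hn (Finset.mem_filter.2 ⟨by simpa using ht, h⟩)
    rcases this with h | h | h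
    · exact ⟨_, h, by simp [hB, ht.1]⟩
    · exact ⟨_, h, by simp [hB]⟩
    · exact ⟨_, h, by simp [hB, ht.1]⟩
  have hle := (Finset.card_le_card hsub).trans (Finset.card_union_le _ _)
  rw [Finset.card_product, Finset.card_erase_of_mem (Finset.mem_univ _),
    Finset.card_erase_of_mem (Finset.mem_univ _), Finset.card_univ] at hle
  exact hle.trans (Nat.add_le_add_left hBcard _)

theorem spannedBox_injOn_isolatedCorners {m : ℕ} (S : Finset (Fin (m + 1) × Fin (m + 1))) :
    Set.InjOn spannedBox (isolatedCorners S :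
      Set ((Fin (m + 1) × Fin (m + 1)) × (Fin (m + 1) × Fin (m + 1)))) := by
  rintro ⟨⟨a, b⟩, ⟨a', b'⟩⟩ hp ⟨⟨c, d⟩, ⟨c', d'⟩⟩ hp' h
  rw [Finset.mem_coe, mem_isolatedCorners] at hp hp'
  simp only [spannedBox, Prod.mk.injEq, Nat.add_right_cancel_iff, ← Fin.ext_iff] at h
  obtain ⟨⟨h1, h2⟩, ⟨h3, h4⟩⟩ := h
  have hx : (a = c ∧ a' = c') ∨ (a = c' ∧ a' = c) := by grind
  have hy : (b = d ∧ b' = d') ∨ (b = d' ∧ b' = d) := by grind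
  rcases hx with ⟨rfl, rfl⟩ | ⟨rfl, rfl⟩ <;> rcases hy with ⟨rfl, rfl⟩ | ⟨rfl, rfl⟩ <;> simp_all

theorem card_isolatedCorners_le_Nboxes {m q : ℕ} (y : Matrix (Fin m) (Fin m) (ZMod q))
    (t : Fin (m + 1) × Fin (m + 1)) :
    (isolatedCorners (Finset.univ.filter
      (fun s => cornerSum (prefixSum y) s t ≠ 0))).card ≤ Nboxes y := by
  refine Finset.card_le_card_of_injOn (t := nzBoxes y) spannedBox (fun p hp => ?_)
    (spannedBox_injOn_isolatedCorners _)
  rw [Finset.mem_coe, mem_isolatedCorners] at hp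
  simp only [Finset.mem_filter, Finset.mem_univ, true_and, not_not] at hp
  refine spannedBox_mem_nzBoxes y p.1 p.2 ?_
  rw [← cornerSum_cornerSum _ t]
  obtain ⟨h1, -, -, h2, h3, h4⟩ := hp
  simpa [cornerSum.eq_def (fun c => cornerSum (prefixSum y) c t), h2, h3, h4] using h1

/-- A matrix with few nonzero boxes is the mixed difference of a potential with at most `w` nonzero
values. -/
theorem exists_sparse_potential {m q w : ℕ} (y : Matrix (Fin m) (Fin m) (ZMod q)) (hw : 1 ≤ w)
    (hwm : 100 * (w : ℝ) ^ 2 ≤ ((m + 1 : ℕ) : ℝ))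
    (hy : (Nboxes y : ℝ) ≤ ((w : ℝ) + 1 / 2) * ((m + 1 : ℕ) : ℝ) ^ 2) :
    ∃ z : Fin (m + 1) × Fin (m + 1) → ZMod q,
      (Finset.univ.filter (fun c => z c ≠ 0)).card ≤ w ∧ mixedDiff z = y := by
  obtain ⟨t, ht⟩ := exists_base_card_le y
  refine ⟨fun c => cornerSum (prefixSum y) c t, ?_, ?_⟩
  · have h1 := card_isolatedCorners_le_Nboxes y t
    have h2 := le_card_isolatedCorners (Finset.univ.filter
      (fun s => cornerSum (prefixSum y) s t ≠ 0))
    set d := (Finset.univ.filter (fun s => cornerSum (prefixSum y) s t ≠ 0)).card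
    rw [Fintype.card_fin, Nat.add_sub_cancel] at h2
    replace h2 := h2.trans (Nat.add_le_add_right h1 _)
    have h2' : (d : ℝ) * (m * m) ≤ Nboxes y + d * (d * ((m + 1 : ℕ) : ℝ)) := by exact_mod_cast h2
    have ht' : ((m + 1 : ℕ) : ℝ) * ((m + 1 : ℕ) : ℝ) * d ≤ 4 * Nboxes y := by exact_mod_cast ht
    have hm : (m : ℝ) = ((m + 1 : ℕ) : ℝ) - 1 := by push_cast; ring
    rw [hm] at h2'
    have hN : (0 : ℝ) < ((m + 1 : ℕ) : ℝ) := by positivity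
    generalize ((m + 1 : ℕ) : ℝ) = N at *
    have hd : (d : ℝ) ≤ 4 * w + 2 := by
      have : N ^ 2 * (d : ℝ) ≤ N ^ 2 * (4 * w + 2) := by linarith
      exact le_of_mul_le_mul_left this (by positivity)
    by_contra! hwd
    have hwd' : (w : ℝ) + 1 ≤ d := by exact_mod_cast hwd
    have hw' : (1 : ℝ) ≤ w := by exact_mod_cast hw
    have hloss : (d : ℝ) * (d + 2) ≤ 48 * (w : ℝ) ^ 2 := by nlinarith
    nlinarith [mul_le_mul_of_nonneg_right hloss hN.le, mul_le_mul_of_nonneg_right hwm hN.le,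
      mul_le_mul_of_nonneg_right hwd' (sq_nonneg N), sq_pos_of_pos hN]
  · conv_rhs => rw [← mixedDiff_prefixSum y]
    simp only [mixedDiff, cornerSum_cornerSum]

/-- There are at most `(|α| |β|) ^ w` functions `α → β` with at most `w` nonzero values. -/
theorem ncard_sparse_le {α β : Type*} [Fintype α] [Fintype β] [Nonempty α] [Zero β]
    [DecidableEq β] (w : ℕ) :
    Set.ncard {z : α → β | (Finset.univ.filter (fun c => z c ≠ 0)).card ≤ w} ≤
      (Fintype.card α * Fintype.card β) ^ w := by
  classical
  let F : (Fin w → α × β) → α → β := fun v c =>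
    if h : ∃ i, (v i).1 = c then (v h.choose).2 else 0
  have hsub : {z : α → β | (Finset.univ.filter (fun c => z c ≠ 0)).card ≤ w} ⊆ Set.range F := by
    intro z hz
    set S := Finset.univ.filter (fun c => z c ≠ 0) with hS
    obtain ⟨e⟩ : Nonempty (S ↪ Fin w) :=
      Function.Embedding.nonempty_of_card_le (by simpa using hz)
    let g : Fin w → α := Function.extend e Subtype.val (fun _ => Classical.arbitrary α)
    refine ⟨fun i => (g i, z (g i)), funext fun c => ?_⟩
    simp only [F]
    split_ifs with h
    · exact congrArg z h.choose_spec
    · by_contra hc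
      refine h ⟨e ⟨c, by simpa [hS] using Ne.symm hc⟩, ?_⟩
      exact e.injective.extend_apply _ _ _
  refine (Set.ncard_le_ncard hsub (Set.finite_range F)).trans ?_
  rw [← Set.image_univ]
  refine (Set.ncard_image_le Set.finite_univ).trans ?_
  simp [Set.ncard_univ]

theorem stmt15 (n q : ℕ) (hn : 3 ≤ n) (hq : 2 ≤ q)
    (ε : ℝ) (hε0 : 0 < ε) (hε1 : ε ≤ 1 / 80)
    (w : ℕ) (hw1 : 1 ≤ w) (hw2 : (w : ℝ) ≤ min (1 / (100 * ε)) (ε * n)) :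
    (Set.ncard {y : Matrix (Fin (n - 1)) (Fin (n - 1)) (ZMod q) |
        (Nboxes y : ℝ) ≤ ((w : ℝ) + 1 / 2) * (n : ℝ) ^ 2} : ℝ)
      ≤ (q : ℝ) ^ (32 * (w : ℝ)) * (n : ℝ) ^ (2 * (w : ℝ)) := by
  obtain ⟨m, rfl⟩ : ∃ m, n = m + 1 := ⟨n - 1, by omega⟩
  have : NeZero q := ⟨by omega⟩
  have hwn : 100 * (w : ℝ) ^ 2 ≤ ((m + 1 : ℕ) : ℝ) := by
    have h1 := hw2.trans (min_le_left _ _)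
    have h2 := hw2.trans (min_le_right _ _)
    rw [le_div_iff₀ (by positivity)] at h1
    have h3 : (0 : ℝ) ≤ w := by positivity
    have h4 := mul_le_mul_of_nonneg_right h1 (Nat.cast_nonneg (α := ℝ) (m + 1))
    nlinarith [mul_le_mul_of_nonneg_left h2 h3]
  have hcard : Set.ncard {y : Matrix (Fin m) (Fin m) (ZMod q) |
      (Nboxes y : ℝ) ≤ ((w : ℝ) + 1 / 2) * ((m + 1 : ℕ) : ℝ) ^ 2}
      ≤ (((m + 1) * (m + 1)) * q) ^ w := by
    refine (Set.ncard_le_ncard (t := mixedDiff '' {z : Fin (m + 1) × Fin (m + 1) → ZMod q |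
      (Finset.univ.filter (fun c => z c ≠ 0)).card ≤ w}) ?_ (Set.toFinite _)).trans
      ((Set.ncard_image_le (Set.toFinite _)).trans ?_)
    · intro y hy
      exact exists_sparse_potential y hw1 hwn hy
    · simpa using ncard_sparse_le (α := Fin (m + 1) × Fin (m + 1)) (β := ZMod q) w
  calc _ ≤ (((((m + 1) * (m + 1)) * q) ^ w : ℕ) : ℝ) := by exact_mod_cast hcard
    _ = (q : ℝ) ^ w * ((m + 1 : ℕ) : ℝ) ^ (2 * w) := by push_cast; rw [pow_mul, ← mul_pow]; ring
    _ ≤ (q : ℝ) ^ (32 * w) * ((m + 1 : ℕ) : ℝ) ^ (2 * w) := by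
      gcongr
      · exact_mod_cast (by omega : 1 ≤ q)
      · omega
    _ = _ := by
      rw [← Real.rpow_natCast, ← Real.rpow_natCast]
      push_cast
      rfl
end
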